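/- arXiv:2510.16151 — 2 statements merged into one kernel-verified Lean document; each statement's English description precedes it below -/
import Mathlib

section
/- Let G be a connected δ-regular graph on n vertices with δ ≥ 2, whose distinct adjacency eigenvalues are θ_0 = δ > θ_1 > ⋯ > θ_d, and let θ_i be the largest eigenvalue not greater than −1 (so i ≥ 1). Set H_2 = n·(δ + θ_i·θ_{i−1}) / ((δ − θ_i)(δ − θ_{i−1})). If α_2(G) = H_2, then for every integer m ≥ 1 one has α((G²)^{⊠m}) = α_2(G)^m; in particular the Shannon capacity Θ(G²) equals H_2. -/
open Polynomial

/-- The independence number of a simple graph: the maximum size of a set of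
pairwise nonadjacent vertices. -/
noncomputable def indepNum {V : Type*} [Fintype V] (G : SimpleGraph V) : ℕ :=
  sSup {n : ℕ | ∃ s : Finset V, s.card = n ∧ ∀ u ∈ s, ∀ v ∈ s, u ≠ v → ¬ G.Adj u v}

/-- The `k`-th power of a graph: two distinct vertices are adjacent iff their
distance in `G` is at most `k`. -/
def graphPower {V : Type*} (G : SimpleGraph V) (k : ℕ) : SimpleGraph V :=
  SimpleGraph.fromRel fun u v => G.dist u v ≤ k

/-- The `m`-th strong power of a graph: two distinct `m`-tuples are adjacent iff
in every coordinate the entries are equal or adjacent. -/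
def strongPower {V : Type*} (G : SimpleGraph V) (m : ℕ) : SimpleGraph (Fin m → V) :=
  SimpleGraph.fromRel fun u v => ∀ j, u j = v j ∨ G.Adj (u j) (v j)

/-- The Shannon capacity of a graph, `sup_m α(G^{⊠m})^{1/m}`. -/
noncomputable def shannonCapacity {V : Type*} [Fintype V] (G : SimpleGraph V) : ℝ :=
  ⨆ m : ℕ+, (indepNum (strongPower G (m : ℕ)) : ℝ) ^ (((m : ℕ) : ℝ))⁻¹


lemma indep_set_bdd {V : Type*} [Fintype V] (G : SimpleGraph V) :
    BddAbove {n : ℕ | ∃ s : Finset V, s.card = n ∧ ∀ u ∈ s, ∀ v ∈ s, u ≠ v → ¬ G.Adj u v} := by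
  refine ⟨Fintype.card V, ?_⟩
  rintro n ⟨s, rfl, -⟩
  exact s.card_le_univ

lemma indep_attained {V : Type*} [Fintype V] (G : SimpleGraph V) :
    ∃ s : Finset V, s.card = indepNum G ∧ ∀ u ∈ s, ∀ v ∈ s, u ≠ v → ¬ G.Adj u v :=
  Nat.sSup_mem (s := {n : ℕ | ∃ s : Finset V, s.card = n ∧ ∀ u ∈ s, ∀ v ∈ s, u ≠ v → ¬ G.Adj u v})
    ⟨0, ∅, by simp⟩ (indep_set_bdd G)

lemma le_indep {V : Type*} [Fintype V] (G : SimpleGraph V) (s : Finset V)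
    (hs : ∀ u ∈ s, ∀ v ∈ s, u ≠ v → ¬ G.Adj u v) : s.card ≤ indepNum G :=
  le_csSup (indep_set_bdd G) ⟨s, rfl, hs⟩

lemma lower_bd {V : Type*} [Fintype V] (G : SimpleGraph V) (m : ℕ) :
    (indepNum G) ^ m ≤ indepNum (strongPower G m) := by
  obtain ⟨s, hs, hi⟩ := indep_attained G
  have := le_indep (strongPower G m) (Fintype.piFinset fun _ => s) (by
    intro u hu v hv huv hadj
    rw [Fintype.mem_piFinset] at hu hv
    obtain ⟨j, hj⟩ := Function.ne_iff.mp huv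
    rw [strongPower, SimpleGraph.fromRel_adj] at hadj
    rcases hadj.2 with h | h
    · rcases h j with h | h
      · exact hj h
      · exact hi _ (hu j) _ (hv j) hj h
    · rcases h j with h | h
      · exact hj h.symm
      · exact hi _ (hu j) _ (hv j) hj h.symm)
  simpa [hs] using this

/-- The tensor-power bound. -/
lemma upper_bd {V : Type*} [Fintype V] [DecidableEq V] (H : SimpleGraph V)
    (B N : Matrix V V ℝ) (c P : ℝ) (hP : 0 < P)
    (hN : ∀ u v, N u v = ∑ w, B w u * B w v)
    (hdiag : ∀ u, N u u = c) (hoff : ∀ u v, u ≠ v → ¬ H.Adj u v → N u v = 0)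
    (hrow : ∀ u, ∑ v, N u v = P) (m : ℕ) :
    (indepNum (strongPower H m) : ℝ) * P ^ m ≤ c ^ m * (Fintype.card V : ℝ) ^ m := by
  classical
  obtain ⟨S, hS, hi⟩ := indep_attained (strongPower H m)
  rw [← hS]
  set T : (Fin m → V) → (Fin m → V) → ℝ := fun w u => ∏ j, B (w j) (u j) with hT
  have key : ∀ u v : Fin m → V, ∑ w, T w u * T w v = ∏ j, N (u j) (v j) := by
    intro u v
    simp only [hT, ← Finset.prod_mul_distrib, hN]
    rw [Finset.prod_univ_sum]
    simp
  have krow : ∀ u : Fin m → V, ∑ v : Fin m → V, ∏ j, N (u j) (v j) = P ^ m := by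
    intro u
    have := Finset.prod_univ_sum (fun _ : Fin m => (Finset.univ : Finset V))
      (fun j v => N (u j) v)
    simp only [hrow, Fintype.piFinset_univ] at this
    rw [← this]; simp
  have gen : ∀ X Y : Finset (Fin m → V),
      ∑ w, (∑ u ∈ X, T w u) * (∑ v ∈ Y, T w v) = ∑ u ∈ X, ∑ v ∈ Y, ∏ j, N (u j) (v j) := by
    intro X Y
    simp only [← key, Finset.sum_mul_sum]
    rw [Finset.sum_comm]
    refine Finset.sum_congr rfl fun u _ => ?_
    rw [Finset.sum_comm]
  have h1 := gen S Finset.univ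
  have h2 := gen S S
  have h3 := gen Finset.univ Finset.univ
  simp only [krow, Finset.sum_const, nsmul_eq_mul] at h1 h3
  have h4 : ∑ u ∈ S, ∑ v ∈ S, ∏ j, N (u j) (v j) = S.card * c ^ m := by
    rw [← nsmul_eq_mul, ← Finset.sum_const]
    refine Finset.sum_congr rfl fun u hu => ?_
    rw [Finset.sum_eq_single u]
    · simp [hdiag]
    · intro v hv hvu
      have hna := hi u hu v hv hvu.symm
      rw [strongPower, SimpleGraph.fromRel_adj] at hna
      push Not at hna
      obtain ⟨j, hj1, hj2⟩ := (hna hvu.symm).1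
      exact Finset.prod_eq_zero (Finset.mem_univ j) (hoff _ _ hj1 hj2)
    · intro h; exact absurd hu h
  rw [h4] at h2
  have cs := Finset.sum_mul_sq_le_sq_mul_sq Finset.univ
    (fun w => ∑ u ∈ S, T w u) (fun w => ∑ u : Fin m → V, T w u)
  simp only [pow_two (∑ u ∈ S, T _ u), pow_two (∑ u : Fin m → V, T _ u)] at cs
  rw [h1, h2, h3] at cs
  have hcard : ((Finset.univ : Finset (Fin m → V)).card : ℝ) = (Fintype.card V : ℝ) ^ m := by
    simp
  rw [hcard] at cs
  rcases Nat.eq_zero_or_pos S.card with h0 | h0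
  · rw [h0]
    rcases isEmpty_or_nonempty V with hV | ⟨⟨x⟩⟩
    · rcases Nat.eq_zero_or_pos m with rfl | hm
      · simp
      · simp [hm.ne']
    · have : 0 ≤ c := by rw [← hdiag x, hN]; exact Finset.sum_nonneg fun w _ => mul_self_nonneg _
      have : 0 ≤ c ^ m * (Fintype.card V : ℝ) ^ m := by positivity
      simpa using this
  · have h0' : (0:ℝ) < S.card := by exact_mod_cast h0
    have hPm : 0 < P ^ m := pow_pos hP m
    have : (S.card * P ^ m) * (S.card * P ^ m) ≤ (S.card * P ^ m) * (c ^ m * (Fintype.card V : ℝ) ^ m) := by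
      nlinarith [cs]
    exact le_of_mul_le_mul_left this (by positivity)

lemma psd_factor {V : Type*} [Fintype V] [DecidableEq V] (A : Matrix V V ℝ) (hA : A.IsHermitian)
    (a b : ℝ) (h : ∀ x ∈ spectrum ℝ A, 0 ≤ (x - a) * (x - b)) :
    ∃ B : Matrix V V ℝ, ∀ u v, ((A - a • 1) * (A - b • 1) : Matrix V V ℝ) u v = ∑ w, B w u * B w v := by
  have hev : ∀ k, 0 ≤ (hA.eigenvalues k - a) * (hA.eigenvalues k - b) := fun k =>
    h _ (hA.eigenvalues_mem_spectrum_real k)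
  set U : Matrix V V ℝ := (hA.eigenvectorUnitary : Matrix V V ℝ) with hU
  have hUU : star U * U = 1 := by simp [hU]
  have hUU' : U * star U = 1 := by simp [hU]
  set D : Matrix V V ℝ := Matrix.diagonal hA.eigenvalues with hD
  have hs : A = U * D * star U := by
    have := hA.spectral_theorem
    simpa [Unitary.conjStarAlgAut_apply, hU, hD, Function.comp_def] using this
  have e : ∀ t : ℝ, A - t • 1 = U * (D - t • 1) * star U := by
    intro t
    rw [mul_sub, sub_mul, ← hs]
    simp [hUU']
  have hN : (A - a • 1) * (A - b • 1) = U * ((D - a • 1) * (D - b • 1)) * star U := by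
    rw [e a, e b]
    calc _ = U * (D - a • 1) * (star U * U) * (D - b • 1) * star U := by noncomm_ring
      _ = _ := by rw [hUU]; noncomm_ring
  have hDD : (D - a • 1) * (D - b • 1) = Matrix.diagonal fun k =>
      (hA.eigenvalues k - a) * (hA.eigenvalues k - b) := by
    rw [hD, Matrix.smul_one_eq_diagonal, Matrix.smul_one_eq_diagonal, Matrix.diagonal_sub,
      Matrix.diagonal_sub, Matrix.diagonal_mul_diagonal]
  refine ⟨fun w u => √((hA.eigenvalues w - a) * (hA.eigenvalues w - b)) * U u w, fun u v => ?_⟩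
  rw [hN, hDD, Matrix.mul_apply]
  refine Finset.sum_congr rfl fun w _ => ?_
  rw [Matrix.mul_diagonal]
  have := Real.mul_self_sqrt (hev w)
  simp only [Matrix.star_apply, star_trivial]
  linear_combination (-(U u w * U v w)) * this

theorem stmt_5 {V : Type*} [Fintype V] [DecidableEq V]
    (G : SimpleGraph V) [DecidableRel G.Adj]
    (hconn : G.Connected) (n δ d : ℕ) (hn : Fintype.card V = n)
    (hδ : 2 ≤ δ) (hreg : G.IsRegularOfDegree δ)
    (θ : Fin (d + 1) → ℝ) (hanti : StrictAnti θ) (hθ0 : θ 0 = (δ : ℝ))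
    (hspec : spectrum ℝ (G.adjMatrix ℝ) = Set.range θ)
    (i : ℕ) (hi1 : 1 ≤ i) (hid : i ≤ d)
    (hile : θ ⟨i, by omega⟩ ≤ -1)
    (hmax : ∀ j : Fin (d + 1), θ j ≤ -1 → θ j ≤ θ ⟨i, by omega⟩)
    (H2 : ℝ)
    (hH2 : H2 = (n : ℝ) * ((δ : ℝ) + θ ⟨i, by omega⟩ * θ ⟨i - 1, by omega⟩) /
      (((δ : ℝ) - θ ⟨i, by omega⟩) * ((δ : ℝ) - θ ⟨i - 1, by omega⟩)))
    (hα : (indepNum (graphPower G 2) : ℝ) = H2) :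
    (∀ m : ℕ, 1 ≤ m →
      indepNum (strongPower (graphPower G 2) m) = (indepNum (graphPower G 2)) ^ m) ∧
    shannonCapacity (graphPower G 2) = H2 := by
  classical
  set a := θ ⟨i, by omega⟩ with ha
  set b := θ ⟨i - 1, by omega⟩ with hb
  set A := G.adjMatrix ℝ with hAdef
  obtain ⟨x0⟩ := hconn.nonempty
  have hα1 : 1 ≤ indepNum (graphPower G 2) := by
    have := le_indep (graphPower G 2) {x0} (by
      intro u hu v hv huv
      simp only [Finset.mem_singleton] at hu hv
      exact absurd (hu.trans hv.symm) huv)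
    simpa using this
  have hα1' : (1:ℝ) ≤ H2 := by rw [← hα]; exact_mod_cast hα1
  have hbδ : b ≤ δ := by
    rw [← hθ0]; exact hanti.antitone (Fin.zero_le _)
  have hbne : (δ:ℝ) - b ≠ 0 := by
    intro h
    rw [h] at hH2
    simp at hH2
    linarith
  have hPb : 0 < (δ:ℝ) - b := lt_of_le_of_ne (by linarith) hbne.symm
  have hδ0 : (0:ℝ) ≤ δ := by positivity
  have hP : 0 < ((δ:ℝ) - a) * (δ - b) := mul_pos (by linarith) hPb
  have hab : a < b := hanti (by rw [Fin.mk_lt_mk]; omega)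
  have hpos : ∀ x ∈ spectrum ℝ A, 0 ≤ (x - a) * (x - b) := by
    rw [hspec]
    rintro _ ⟨j, rfl⟩
    rcases Nat.lt_or_ge j.val i with h | h
    · have : b ≤ θ j := hanti.antitone (by rw [Fin.le_def]; simp; omega)
      exact mul_nonneg (by linarith) (by linarith)
    · have : θ j ≤ a := hanti.antitone (by rw [Fin.le_def]; exact h)
      exact mul_nonneg_of_nonpos_of_nonpos (by linarith) (by linarith)
  have hAh : A.IsHermitian := by
    have := G.isSymm_adjMatrix (α := ℝ)
    rw [Matrix.IsHermitian, Matrix.conjTranspose_eq_transpose_of_trivial]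
    exact this
  obtain ⟨B, hB⟩ := psd_factor A hAh a b hpos
  have hexp : ((A - a • 1) * (A - b • 1) : Matrix V V ℝ) = A * A - (a + b) • A + (a * b) • 1 := by
    simp only [sub_mul, mul_sub, smul_mul_assoc, mul_smul_comm, one_mul, mul_one, smul_sub, smul_smul, add_smul]
    rw [mul_comm b a]
    abel
  have hAA : ∀ u v, u ≠ v → ¬ (graphPower G 2).Adj u v → A u v = 0 ∧ (A * A) u v = 0 := by
    intro u v huv hna
    rw [graphPower, SimpleGraph.fromRel_adj] at hna
    push Not at hna
    have hd := (hna huv).1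
    constructor
    · rw [hAdef, SimpleGraph.adjMatrix_apply, if_neg]
      intro h
      have := SimpleGraph.dist_le h.toWalk
      simp at this
      omega
    · rw [Matrix.mul_apply]
      refine Finset.sum_eq_zero fun w _ => ?_
      rw [hAdef, SimpleGraph.adjMatrix_apply, SimpleGraph.adjMatrix_apply]
      by_cases h1 : G.Adj u w
      · by_cases h2 : G.Adj w v
        · exfalso
          have := SimpleGraph.dist_le (SimpleGraph.Walk.cons h1 h2.toWalk)
          simp at this
          omega
        · simp [h2]
      · simp [h1]
  have hrowA : ∀ u, ∑ v, A u v = δ := by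
    intro u
    have h := hreg u
    rw [← SimpleGraph.card_neighborFinset_eq_degree, SimpleGraph.neighborFinset_eq_filter] at h
    simp [hAdef, SimpleGraph.adjMatrix_apply, h]
  have hub := upper_bd (graphPower G 2) B _ (δ + a * b) _ hP hB
    (by
      intro u
      rw [hexp]
      have : (A * A) u u = δ := by
        rw [hAdef, SimpleGraph.adjMatrix_mul_self_apply_self, hreg u]
      have h0 : A u u = 0 := by simp [hAdef]
      rw [Matrix.add_apply, Matrix.sub_apply, this, Matrix.smul_apply, Matrix.smul_apply, h0]
      simp)
    (by
      intro u v huv hna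
      obtain ⟨h1, h2⟩ := hAA u v huv hna
      rw [hexp]
      simp [h1, h2, huv])
    (by
      intro u
      rw [hexp]
      have h2 : ∑ v, (A * A) u v = δ * δ := by
        simp only [Matrix.mul_apply]
        rw [Finset.sum_comm]
        simp only [← Finset.mul_sum, hrowA, ← Finset.sum_mul]
      simp only [Matrix.add_apply, Matrix.sub_apply, Matrix.smul_apply, Finset.sum_add_distrib,
        Finset.sum_sub_distrib, smul_eq_mul, ← Finset.mul_sum, hrowA, h2]
      simp [Matrix.one_apply]
      ring)
  have main : ∀ m : ℕ, indepNum (strongPower (graphPower G 2) m) = (indepNum (graphPower G 2)) ^ m := by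
    intro m
    refine le_antisymm ?_ (lower_bd _ _)
    have h := hub m
    rw [← le_div_iff₀ (pow_pos hP m), ← mul_pow, ← div_pow, hn, mul_comm _ (n:ℝ), ← hH2, ← hα] at h
    exact_mod_cast h
  refine ⟨fun m _ => main m, ?_⟩
  rw [shannonCapacity]
  have : ∀ m : ℕ+, (indepNum (strongPower (graphPower G 2) (m:ℕ)) : ℝ) ^ (((m : ℕ) : ℝ))⁻¹ = H2 := by
    intro m
    rw [main, Nat.cast_pow, hα]
    exact Real.pow_rpow_inv_natCast (by linarith) m.ne_zero
  simp only [this]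
  exact ciSup_const
end

section
/- Let G be a connected δ-regular graph on n vertices that is k-partially walk-regular, with distinct adjacency eigenvalues θ_0 = δ > θ_1 > ⋯ > θ_d and multiplicities m_0, m_1, …, m_d. Let p be a real polynomial of degree at most k with p(θ_0) = 1 and p(θ_i) ≥ 0 for all 1 ≤ i ≤ d, and set Ψ = Σ_{i=0}^{d} m_i·p(θ_i) = tr p(A). Then there exists a real symmetric matrix M, with rows and columns indexed by V, such that M_{uv} = 1 whenever u = v or u and v are distinct and nonadjacent in G^k (i.e., at distance greater than k in G), and every eigenvalue of M is at most Ψ. Consequently, the Lovász theta number of G^k is at most tr p(A). -/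
open Polynomial

/-- The Lovász theta number of a graph `H`: the minimum, over all real symmetric
matrices `M` with `M u v = 1` whenever `u = v` or `u, v` are nonadjacent in `H`,
of the largest eigenvalue of `M`. -/
noncomputable def lovaszTheta {V : Type*} [Fintype V] [DecidableEq V] (H : SimpleGraph V) : ℝ :=
  sInf {r : ℝ | ∃ M : Matrix V V ℝ, M.IsSymm ∧
    (∀ u v : V, ¬ H.Adj u v → M u v = 1) ∧ IsGreatest (spectrum ℝ M) r}

theorem aux_diag {V : Type*} [Fintype V] [DecidableEq V] {A : Matrix V V ℝ} (hA : A.IsHermitian)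
    (p : ℝ[X]) : aeval A p = (hA.eigenvectorUnitary : Matrix V V ℝ) *
      Matrix.diagonal (fun i => p.eval (hA.eigenvalues i)) *
      star (hA.eigenvectorUnitary : Matrix V V ℝ) := by
  have h1 : aeval (Matrix.diagonal hA.eigenvalues) p =
      Matrix.diagonal (fun i => p.eval (hA.eigenvalues i)) := by
    have := Polynomial.aeval_algHom_apply (Matrix.diagonalAlgHom ℝ (n := V) (α := ℝ))
      hA.eigenvalues p
    simp only [Matrix.diagonalAlgHom_apply] at this
    rw [this]
    congr 1
    funext i
    have h2 := Polynomial.aeval_algHom_apply (Pi.evalAlgHom ℝ (fun _ : V => ℝ) i) hA.eigenvalues p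
    simp only [Pi.evalAlgHom_apply] at h2
    rw [← h2, Polynomial.coe_aeval_eq_eval]
  have h3 : A = Unitary.conjStarAlgAut ℝ (Matrix V V ℝ) hA.eigenvectorUnitary
      (Matrix.diagonal hA.eigenvalues) := by
    have := hA.spectral_theorem
    exact this
  conv_lhs => rw [h3]
  rw [Polynomial.aeval_algHom_apply, h1, Unitary.conjStarAlgAut_apply]

theorem aux_trace {V : Type*} [Fintype V] [DecidableEq V] {A : Matrix V V ℝ} (hA : A.IsHermitian)
    (p : ℝ[X]) : (aeval A p).trace = ∑ i, p.eval (hA.eigenvalues i) := by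
  rw [aux_diag hA, Matrix.trace_mul_comm, ← mul_assoc, Unitary.coe_star_mul_self, one_mul,
    Matrix.trace_diagonal]

theorem aux_psd {V : Type*} [Fintype V] [DecidableEq V] {A : Matrix V V ℝ} (hA : A.IsHermitian)
    (p : ℝ[X]) (h : ∀ i, 0 ≤ p.eval (hA.eigenvalues i)) : (aeval A p).PosSemidef := by
  rw [aux_diag hA]
  exact (Matrix.PosSemidef.diagonal h).mul_mul_conjTranspose_same _

theorem aux_theta_le {V : Type*} [Fintype V] [DecidableEq V] [Nonempty V] (H : SimpleGraph V)
    (M : Matrix V V ℝ) (hM : M.IsSymm) (h1 : ∀ u v : V, ¬ H.Adj u v → M u v = 1) (c : ℝ)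
    (hc : ∀ x ∈ spectrum ℝ M, x ≤ c) : lovaszTheta H ≤ c := by
  have hH : M.IsHermitian := hM
  have hne : (spectrum ℝ M).Nonempty := by
    rw [hH.spectrum_real_eq_range_eigenvalues]; exact Set.range_nonempty _
  have hfin : (spectrum ℝ M).Finite := by
    rw [hH.spectrum_real_eq_range_eigenvalues]; exact Set.finite_range _
  obtain ⟨r, hr⟩ : ∃ r, IsGreatest (spectrum ℝ M) r := by
    obtain ⟨r, hr, hr'⟩ := Set.exists_max_image _ id hfin hne
    exact ⟨r, hr, fun x hx => hr' x hx⟩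
  refine le_trans (b := r) ?_ (hc r hr.1)
  unfold lovaszTheta
  refine csInf_le ?_ ⟨M, hM, h1, hr⟩
  refine ⟨0, ?_⟩
  rintro s ⟨N, hN, hN1, hs⟩
  have hNH : N.IsHermitian := hN
  by_contra hlt
  push Not at hlt
  have ht := hNH.trace_eq_sum_eigenvalues
  have h2 : N.trace = Fintype.card V := by
    simp [Matrix.trace, hN1]
  have h3 : ∑ i, hNH.eigenvalues i ≤ 0 := by
    refine Finset.sum_nonpos fun i _ => ?_
    have := hs.2 (by rw [hNH.spectrum_real_eq_range_eigenvalues]; exact ⟨i, rfl⟩ :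
      hNH.eigenvalues i ∈ spectrum ℝ N)
    linarith
  have h4 : (0 : ℝ) < Fintype.card V := by exact_mod_cast Fintype.card_pos
  rw [h2] at ht
  simp only [RCLike.ofReal_real_eq_id, id] at ht
  linarith

theorem aux_psd_J {V : Type*} [Fintype V] [DecidableEq V] [Nonempty V] (B : Matrix V V ℝ)
    (hB : B.PosSemidef) (h1 : B.mulVec (fun _ => 1) = fun _ => 1) :
    ((Fintype.card V : ℝ) • B - Matrix.of fun _ _ => (1 : ℝ)).PosSemidef := by
  have hcard : (0 : ℝ) < Fintype.card V := by exact_mod_cast Fintype.card_pos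
  set J : Matrix V V ℝ := Matrix.of fun _ _ => (1 : ℝ) with hJ
  set n : ℝ := (Fintype.card V : ℝ) with hn
  have hJT : J.conjTranspose = J := by ext; simp [hJ]
  have hBJ : B * J = J := by
    ext u v
    have := congrFun h1 u
    simp only [Matrix.mulVec, dotProduct] at this
    simpa [Matrix.mul_apply, hJ] using this
  have hJB : J * B = J := by
    have := congrArg Matrix.conjTranspose hBJ
    rwa [Matrix.conjTranspose_mul, hJT, hB.isHermitian.eq] at this
  have hJJ : J * J = n • J := by
    ext u v
    simp [Matrix.mul_apply, hJ, hn]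
  have key := (hB.conjTranspose_mul_mul_same (1 - n⁻¹ • J)).smul hcard.le
  convert key using 1
  rw [Matrix.conjTranspose_sub, Matrix.conjTranspose_smul, hJT]
  simp only [Matrix.conjTranspose_one, star_trivial, sub_mul, mul_sub, one_mul, mul_one,
    Matrix.smul_mul, Matrix.mul_smul, hBJ, hJB, hJJ, smul_sub, smul_smul]
  have : n ≠ 0 := hcard.ne'
  field_simp
  simp

theorem aux_mulVec {V : Type*} [Fintype V] [DecidableEq V] (A : Matrix V V ℝ) (p : ℝ[X]) (c : ℝ)
    (w : V → ℝ) (h : A.mulVec w = c • w) : (aeval A p).mulVec w = p.eval c • w := by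
  have hp : ∀ m : ℕ, (A ^ m).mulVec w = c ^ m • w := by
    intro m
    induction m with
    | zero => simp
    | succ m ih => rw [pow_succ, ← Matrix.mulVec_mulVec, h, Matrix.mulVec_smul, ih, smul_smul,
        pow_succ, mul_comm]
  rw [Polynomial.aeval_eq_sum_range, Matrix.sum_mulVec, Polynomial.eval_eq_sum_range,
    Finset.sum_smul]
  refine Finset.sum_congr rfl fun i _ => ?_
  rw [Matrix.smul_mulVec, hp, smul_smul]

theorem stmt_6 {V : Type*} [Fintype V] [DecidableEq V]
    (G : SimpleGraph V) [DecidableRel G.Adj]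
    (hconn : G.Connected) (n δ d k : ℕ) (hn : Fintype.card V = n)
    (hreg : G.IsRegularOfDegree δ)
    (hwr : ∀ ℓ : ℕ, ℓ ≤ k → ∀ u v : V,
      ((G.adjMatrix ℝ) ^ ℓ) u u = ((G.adjMatrix ℝ) ^ ℓ) v v)
    (θ : Fin (d + 1) → ℝ) (hanti : StrictAnti θ) (hθ0 : θ 0 = (δ : ℝ))
    (mult : Fin (d + 1) → ℕ)
    (hchar : (G.adjMatrix ℝ).charpoly = ∏ i : Fin (d + 1), (X - C (θ i)) ^ (mult i))
    (p : ℝ[X]) (hdeg : p.natDegree ≤ k)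
    (hp0 : p.eval (θ 0) = 1)
    (hpnn : ∀ i : Fin (d + 1), 1 ≤ (i : ℕ) → 0 ≤ p.eval (θ i))
    (Ψ : ℝ) (hΨ : Ψ = ∑ i : Fin (d + 1), (mult i : ℝ) * p.eval (θ i)) :
    (∃ M : Matrix V V ℝ, M.IsSymm ∧
      (∀ u v : V, ¬ (graphPower G k).Adj u v → M u v = 1) ∧
      ∀ x ∈ spectrum ℝ M, x ≤ Ψ) ∧
    lovaszTheta (graphPower G k) ≤ (Polynomial.aeval (G.adjMatrix ℝ) p).trace := by
  have : Nonempty V := hconn.nonempty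
  set A : Matrix V V ℝ := G.adjMatrix ℝ with hAdef
  have hA : A.IsHermitian := G.isSymm_adjMatrix
  have hcard : (0 : ℝ) < Fintype.card V := by exact_mod_cast Fintype.card_pos
  have hroots : Finset.univ.val.map hA.eigenvalues =
      Finset.univ.val.bind fun i : Fin (d + 1) => mult i • ({θ i} : Multiset ℝ) := by
    have h1 := hA.roots_charpoly_eq_eigenvalues
    rw [hchar, Polynomial.roots_prod _ _
      (Finset.prod_ne_zero_iff.2 fun i _ => pow_ne_zero _ (X_sub_C_ne_zero _))] at h1
    simp only [roots_pow, roots_X_sub_C] at h1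
    exact h1.symm
  have htr : (aeval A p).trace = Ψ := by
    rw [aux_trace hA, hΨ]
    have := congrArg (fun s : Multiset ℝ => (s.map fun x => p.eval x).sum) hroots
    simp only [Multiset.map_map, Multiset.map_bind, Multiset.sum_bind, Multiset.map_nsmul,
      Multiset.map_singleton, Multiset.sum_nsmul, Multiset.sum_singleton, nsmul_eq_mul] at this
    exact this
  have hnn : ∀ i, 0 ≤ p.eval (hA.eigenvalues i) := by
    intro i
    have hm : hA.eigenvalues i ∈ Finset.univ.val.map hA.eigenvalues :=
      Multiset.mem_map_of_mem _ (Finset.mem_univ i)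
    rw [hroots, Multiset.mem_bind] at hm
    obtain ⟨j, -, hj⟩ := hm
    have hj' : hA.eigenvalues i = θ j := by
      simpa using Multiset.mem_of_mem_nsmul hj
    rw [hj']
    by_cases h0 : j = 0
    · rw [h0, hp0]; exact zero_le_one
    · exact hpnn j (Nat.one_le_iff_ne_zero.2 fun h => h0 (Fin.ext h))
  have hB := aux_psd hA p hnn
  have hB1 : (aeval A p).mulVec (fun _ => 1) = fun _ => 1 := by
    rw [aux_mulVec A p δ]
    · rw [← hθ0, hp0, one_smul]
    · funext v
      have := SimpleGraph.adjMatrix_mulVec_const_apply (α := ℝ) (G := G) (a := 1) (v := v)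
      rw [hreg v] at this
      rw [mul_one] at this
      rw [Pi.smul_apply, smul_eq_mul, mul_one]
      exact this
  have hP := aux_psd_J _ hB hB1
  have hsum : aeval A p = ∑ i ∈ Finset.range (k + 1), p.coeff i • A ^ i :=
    Polynomial.aeval_eq_sum_range' (by omega) _
  have hdiag : ∀ u, (Fintype.card V : ℝ) * (aeval A p) u u = Ψ := by
    intro u
    have : ∀ v, (aeval A p) v v = (aeval A p) u u := by
      intro v
      rw [hsum, Matrix.sum_apply, Matrix.sum_apply]
      refine Finset.sum_congr rfl fun i hi => ?_
      rw [Matrix.smul_apply, Matrix.smul_apply,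
        hwr i (by have := Finset.mem_range.1 hi; omega) v u]
    rw [← htr]
    simp [Matrix.trace, this]
  have hoff : ∀ u v, k < G.dist u v → (aeval A p) u v = 0 := by
    intro u v huv
    rw [hsum, Matrix.sum_apply]
    refine Finset.sum_eq_zero fun i hi => ?_
    have hi' := Finset.mem_range.1 hi
    rw [Matrix.smul_apply, hAdef, SimpleGraph.adjMatrix_pow_apply_eq_card_walk]
    have : IsEmpty ↑{q : G.Walk u v | q.length = i} := by
      refine ⟨fun ⟨q, hq⟩ => ?_⟩
      have h1 := SimpleGraph.dist_le q
      have h2 : q.length = i := hq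
      omega
    rw [Fintype.card_eq_zero]
    simp
  set M : Matrix V V ℝ := algebraMap ℝ (Matrix V V ℝ) Ψ -
    ((Fintype.card V : ℝ) • aeval A p - Matrix.of fun _ _ => (1 : ℝ)) with hM
  have hMs : M.IsSymm := by
    have h1 : (algebraMap ℝ (Matrix V V ℝ) Ψ).IsSymm := by
      rw [Matrix.algebraMap_eq_diagonal]; exact Matrix.isSymm_diagonal _
    have h2 : ((Fintype.card V : ℝ) • aeval A p - Matrix.of fun _ _ => (1 : ℝ)).IsSymm :=
      hP.isHermitian
    exact h1.sub h2
  have hM1 : ∀ u v : V, ¬ (graphPower G k).Adj u v → M u v = 1 := by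
    intro u v huv
    by_cases h : u = v
    · subst h
      simp [hM, Matrix.algebraMap_eq_diagonal, hdiag]
    · have : k < G.dist u v := by
        by_contra hle
        exact huv (by simp [graphPower, h]; left; omega)
      simp [hM, Matrix.algebraMap_eq_diagonal, h, hoff u v this]
  have hsp : ∀ x ∈ spectrum ℝ M, x ≤ Ψ := by
    intro x hx
    rw [hM, ← spectrum.singleton_sub_eq] at hx
    obtain ⟨a, ha, y, hy, rfl⟩ := hx
    have h0 := (Matrix.posSemidef_iff_isHermitian_and_spectrum_nonneg.1 hP).2 hy
    have ha' : a = Ψ := ha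
    have h0' : 0 ≤ y := h0
    show a - y ≤ Ψ
    linarith
  refine ⟨⟨M, hMs, hM1, hsp⟩, ?_⟩
  rw [htr]
  exact aux_theta_le _ M hMs hM1 _ hsp
end
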